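/- Let I be a linearly ordered type and C a commutative ring containing ℚ. Let V, W be nonempty words over I with V ≤dlex W. Then the following are equivalent: (i) there exist nonempty words V1, V2, V3 over I with V1 <dlex V3 such that (V,W) belongs to the set of variables of r(V1,V2,V3) and every variable p of r(V1,V2,V3) satisfies p ≼ (V,W) (i.e., (V,W) is the ≼-greatest variable appearing in r(V1,V2,V3)); (ii) V is not a Lyndon word, or there exist nonempty words W1, W2 with W1 <dlex V such that W is the lexicographically greatest element of the multiset sh(W1,W2). -/

import Mathlib

open scoped Classical

/-- Degree-lexicographic strict order on words over a linearly ordered alphabet: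
first compare lengths, then compare lexicographically. -/
def DlexLt {I : Type*} [LinearOrder I] (V W : List I) : Prop :=
  V.length < W.length ∨ (V.length = W.length ∧ V < W)

/-- Degree-lexicographic (non-strict) order on words. -/
def DlexLe {I : Type*} [LinearOrder I] (V W : List I) : Prop :=
  DlexLt V W ∨ V = W

theorem dlexLe_total {I : Type*} [LinearOrder I] (V W : List I) :
    DlexLe V W ∨ DlexLe W V := by
  rcases lt_trichotomy V.length W.length with h | h | h
  · exact Or.inl (Or.inl (Or.inl h))
  · rcases lt_trichotomy V W with h' | h' | h'
    · exact Or.inl (Or.inl (Or.inr ⟨h, h'⟩))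
    · exact Or.inl (Or.inr h')
    · exact Or.inr (Or.inl (Or.inr ⟨h.symm, h'⟩))
  · exact Or.inr (Or.inl (Or.inl h))

/-- The type `P` of pairs `(V, W)` of nonempty words with `V ≤dlex W`. -/
abbrev WordPair (I : Type*) [LinearOrder I] : Type _ :=
  {p : List I × List I // p.1 ≠ [] ∧ p.2 ≠ [] ∧ DlexLe p.1 p.2}

/-- `χ(A, B)`: the pair `(A, B)` normalized so that the first component is
`≤dlex` the second one. -/
noncomputable def chi {I : Type*} [LinearOrder I] (A B : List I)
    (hA : A ≠ []) (hB : B ≠ []) : WordPair I :=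
  if h : DlexLe A B then ⟨(A, B), hA, hB, h⟩
  else ⟨(B, A), hB, hA, (dlexLe_total A B).resolve_left h⟩

/-- The strict order `≺` on `WordPair I`, comparing `(V, W)` by the triple
`(V.length + W.length, V, W)` lexicographically (words compared by `dlex`). -/
def PairLt {I : Type*} [LinearOrder I] (p q : WordPair I) : Prop :=
  p.val.1.length + p.val.2.length < q.val.1.length + q.val.2.length ∨
  (p.val.1.length + p.val.2.length = q.val.1.length + q.val.2.length ∧
    (DlexLt p.val.1 q.val.1 ∨ (p.val.1 = q.val.1 ∧ DlexLt p.val.2 q.val.2)))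

/-- The order `≼` on `WordPair I`. -/
def PairLe {I : Type*} [LinearOrder I] (p q : WordPair I) : Prop :=
  PairLt p q ∨ p = q

/-- The multiset of shuffles of two words. -/
def shuffles {I : Type*} : List I → List I → Multiset (List I)
  | [], w => {w}
  | x :: v, [] => {x :: v}
  | x :: v, y :: w =>
      ((shuffles v (y :: w)).map (x :: ·)) + ((shuffles (x :: v) w).map (y :: ·))
  termination_by v w => v.length + w.length

/-- The variable `X (χ(A, B))` of the polynomial ring `MvPolynomial (WordPair I) C`
(`0` in the degenerate case of an empty word, which never occurs below). -/
noncomputable def Xchi {I : Type*} [LinearOrder I] (C : Type*) [CommRing C]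
    (A B : List I) : MvPolynomial (WordPair I) C :=
  if h : A ≠ [] ∧ B ≠ [] then MvPolynomial.X (chi A B h.1 h.2) else 0

/-- `Σ_{U ∈ sh(A,B)} X(χ(U, W))`, with multiplicity. -/
noncomputable def shSumR {I : Type*} [LinearOrder I] (C : Type*) [CommRing C]
    (A B W : List I) : MvPolynomial (WordPair I) C :=
  ((shuffles A B).map fun U => Xchi C U W).sum

/-- `Σ_{U ∈ sh(A,B)} X(χ(V, U))`, with multiplicity. -/
noncomputable def shSumL {I : Type*} [LinearOrder I] (C : Type*) [CommRing C]
    (V A B : List I) : MvPolynomial (WordPair I) C :=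
  ((shuffles A B).map fun U => Xchi C V U).sum

/-- The defining relation `r(V1, V2, V3)` of the ring of constants `C₂` of the free
integro-differential ring, as a polynomial in `MvPolynomial (WordPair I) C`. -/
noncomputable def rPoly {I : Type*} [LinearOrder I] (C : Type*) [CommRing C]
    (V1 V2 V3 : List I) : MvPolynomial (WordPair I) C :=
  shSumR C V1 V2 V3 - shSumL C V1 V2 V3
  + ∑ j ∈ Finset.range V2.length,
      ((∑ i ∈ Finset.Ico (1 - j) V1.length,
          Xchi C (V1.drop i) (V2.drop j) * shSumR C (V1.take i) (V2.take j) V3)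
        - ∑ k ∈ Finset.Ico (1 - j) V3.length,
          shSumL C V1 (V2.take j) (V3.take k) * Xchi C (V2.drop j) (V3.drop k))

/-- A word is a Lyndon word iff it is nonempty and lexicographically smaller than each of
its proper nonempty suffixes. -/
def IsLyndonWord {I : Type*} [LinearOrder I] (V : List I) : Prop :=
  V ≠ [] ∧ ∀ A U : List I, A ≠ [] → U ≠ [] → V = A ++ U → V < U

section Shuffles

variable {I : Type*}

theorem shuffles_nil_left (w : List I) : shuffles [] w = {w} := by
  rw [shuffles]

theorem shuffles_nil_right (v : List I) : shuffles v [] = {v} := by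
  cases v <;> rw [shuffles]

theorem mem_shuffles_cons_cons {x y : I} {v w U : List I} :
    U ∈ shuffles (x :: v) (y :: w) ↔
      (∃ T ∈ shuffles v (y :: w), x :: T = U) ∨ ∃ T ∈ shuffles (x :: v) w, y :: T = U := by
  rw [shuffles]
  simp

theorem cons_mem_shuffles_left {x : I} {v w T : List I} (h : T ∈ shuffles v w) :
    x :: T ∈ shuffles (x :: v) w := by
  cases w with
  | nil => simpa [shuffles_nil_right] using h
  | cons y w => exact mem_shuffles_cons_cons.2 (Or.inl ⟨T, h, rfl⟩)

theorem cons_mem_shuffles_right {y : I} {v w T : List I} (h : T ∈ shuffles v w) :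
    y :: T ∈ shuffles v (y :: w) := by
  cases v with
  | nil => simpa [shuffles_nil_left] using h
  | cons x v => exact mem_shuffles_cons_cons.2 (Or.inr ⟨T, h, rfl⟩)

theorem shuffles_comm (v w : List I) : shuffles v w = shuffles w v := by
  induction v generalizing w with
  | nil => rw [shuffles_nil_left, shuffles_nil_right]
  | cons x v ihv =>
    induction w with
    | nil => rw [shuffles_nil_left, shuffles_nil_right]
    | cons y w ihw => rw [shuffles, shuffles, ihv, ihw, add_comm]

theorem append_mem_shuffles (v w : List I) : v ++ w ∈ shuffles v w := by
  induction v with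
  | nil => simp [shuffles_nil_left]
  | cons x v ih => exact cons_mem_shuffles_left ih

theorem append_mem_shuffles_swap (v w : List I) : w ++ v ∈ shuffles v w :=
  shuffles_comm v w ▸ append_mem_shuffles w v

theorem length_of_mem_shuffles {v w U : List I} (h : U ∈ shuffles v w) :
    U.length = v.length + w.length := by
  induction v generalizing w U with
  | nil => simp_all [shuffles_nil_left]
  | cons x v ihv =>
    induction w generalizing U with
    | nil => simp_all [shuffles_nil_right]
    | cons y w ihw =>
      rcases mem_shuffles_cons_cons.1 h with ⟨T, hT, rfl⟩ | ⟨T, hT, rfl⟩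
      · simp [ihv hT]; omega
      · simp [ihw hT]; omega

theorem ne_nil_of_mem_shuffles {v w U : List I} (h : U ∈ shuffles v w) (hv : v ≠ []) :
    U ≠ [] := by
  have := length_of_mem_shuffles h
  have := List.length_pos_of_ne_nil hv
  exact List.ne_nil_of_length_pos (by omega)

end Shuffles

section GreatestShuffle

variable {I : Type*} [LinearOrder I]

theorem cons_le_cons_iff {x y : I} {v w : List I} :
    x :: v ≤ y :: w ↔ x < y ∨ x = y ∧ v ≤ w := by
  simp only [le_iff_lt_or_eq, List.cons_lt_cons_iff, List.cons.injEq]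
  tauto

theorem nil_lt_of_ne_nil {v : List I} (hv : v ≠ []) : [] < v := by
  cases v with
  | nil => exact absurd rfl hv
  | cons x v => exact List.nil_lt_cons x v

theorem nil_le (v : List I) : [] ≤ v := by
  rcases eq_or_ne v [] with rfl | hv
  · exact le_rfl
  · exact (nil_lt_of_ne_nil hv).le

theorem not_cons_le_nil (x : I) (v : List I) : ¬ x :: v ≤ [] :=
  not_le.2 (List.nil_lt_cons x v)

theorem append_le_append_iff_left (P A B : List I) : P ++ A ≤ P ++ B ↔ A ≤ B := by
  induction P with
  | nil => rfl
  | cons x P ih => simpa [cons_le_cons_iff] using ih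

theorem le_append (v w : List I) : v ≤ v ++ w := by
  simpa using (append_le_append_iff_left v [] w).2 (nil_le w)

/-- If `B ≤ A`, a common prefix `C` may be taken from the smaller word
without decreasing the shuffle. -/
theorem exists_ge_shuffle_exchange (C A B : List I) (hBA : B ≤ A) {U : List I}
    (hU : U ∈ shuffles (C ++ A) B) : ∃ T ∈ shuffles A (C ++ B), U ≤ T := by
  induction h : C.length + 2 * B.length using Nat.strong_induction_on
    generalizing C A B U with
  | _ k ih =>
  subst h
  rcases C with _ | ⟨c, C⟩
  · exact ⟨U, hU, le_rfl⟩
  rcases B with _ | ⟨y, B⟩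
  · rw [shuffles_nil_right, Multiset.mem_singleton] at hU
    subst hU
    exact ⟨_, by simpa using append_mem_shuffles_swap A (c :: C), le_rfl⟩
  rcases mem_shuffles_cons_cons.1 hU with ⟨T, hT, rfl⟩ | ⟨T, hT, rfl⟩
  · obtain ⟨S, hS, hle⟩ := ih _ (by simp) C A (y :: B) hBA hT rfl
    exact ⟨c :: S, cons_mem_shuffles_right hS, by simpa [cons_le_cons_iff] using hle⟩
  · rcases A with _ | ⟨x, A⟩
    · exact absurd hBA (not_cons_le_nil _ _)
    rcases cons_le_cons_iff.1 hBA with hlt | ⟨rfl, hBA'⟩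
    · exact ⟨_, append_mem_shuffles _ _, cons_le_cons_iff.2 (Or.inl hlt)⟩
    · obtain ⟨S, hS, hle⟩ := ih _ (by simp; omega) (c :: C ++ [y]) A B hBA'
        (by simpa using hT) rfl
      exact ⟨y :: S, cons_mem_shuffles_left (by simpa using hS),
        cons_le_cons_iff.2 (Or.inr ⟨rfl, hle⟩)⟩

theorem exists_ge_shuffle_of_le {A A' B U : List I} (hA : A ≤ A') (hU : U ∈ shuffles A B) :
    ∃ T ∈ shuffles A' B, U ≤ T := by
  induction h : A.length + B.length using Nat.strong_induction_on generalizing A A' B U with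
  | _ k ih =>
  subst h
  rcases A with _ | ⟨x, A⟩
  · rw [shuffles_nil_left, Multiset.mem_singleton] at hU
    subst hU
    exact ⟨_, append_mem_shuffles_swap A' U, le_append U A'⟩
  rcases B with _ | ⟨y, B⟩
  · rw [shuffles_nil_right, Multiset.mem_singleton] at hU
    subst hU
    exact ⟨A', by simp [shuffles_nil_right], hA⟩
  rcases mem_shuffles_cons_cons.1 hU with ⟨T, hT, rfl⟩ | ⟨T, hT, rfl⟩
  · rcases A' with _ | ⟨a, A'⟩
    · exact absurd hA (not_cons_le_nil _ _)
    rcases cons_le_cons_iff.1 hA with hlt | ⟨rfl, hA'⟩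
    · exact ⟨_, append_mem_shuffles _ _, cons_le_cons_iff.2 (Or.inl hlt)⟩
    · obtain ⟨S, hS, hle⟩ := ih _ (by simp) hA' hT rfl
      exact ⟨x :: S, cons_mem_shuffles_left hS, cons_le_cons_iff.2 (Or.inr ⟨rfl, hle⟩)⟩
  · obtain ⟨S, hS, hle⟩ := ih _ (by simp) hA hT rfl
    exact ⟨y :: S, cons_mem_shuffles_right hS, cons_le_cons_iff.2 (Or.inr ⟨rfl, hle⟩)⟩

/-- The greedy shuffle of two words: always take the next letter from the larger word. -/
noncomputable def greedyShuffle : List I → List I → List I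
  | [], w => w
  | x :: v, [] => x :: v
  | x :: v, y :: w =>
      if y :: w ≤ x :: v then x :: greedyShuffle v (y :: w) else y :: greedyShuffle (x :: v) w
  termination_by v w => v.length + w.length

theorem greedyShuffle_nil_left (w : List I) : greedyShuffle [] w = w := by
  rw [greedyShuffle]

theorem greedyShuffle_nil_right (v : List I) : greedyShuffle v [] = v := by
  cases v <;> rw [greedyShuffle]

theorem greedyShuffle_cons_left {x : I} {v w : List I} (h : w ≤ x :: v) :
    greedyShuffle (x :: v) w = x :: greedyShuffle v w := by
  cases w with
  | nil => simp [greedyShuffle_nil_right]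
  | cons y w => rw [greedyShuffle, if_pos h]

theorem greedyShuffle_cons_right {y : I} {v w : List I} (h : v < y :: w) :
    greedyShuffle v (y :: w) = y :: greedyShuffle v w := by
  cases v with
  | nil => simp [greedyShuffle_nil_left]
  | cons x v => rw [greedyShuffle, if_neg (not_le.2 h)]

theorem greedyShuffle_mem (A B : List I) : greedyShuffle A B ∈ shuffles A B := by
  induction A generalizing B with
  | nil => simp [shuffles_nil_left, greedyShuffle_nil_left]
  | cons x A ihA =>
    induction B with
    | nil => simp [shuffles_nil_right, greedyShuffle_nil_right]
    | cons y B ihB =>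
      rcases le_or_gt (y :: B) (x :: A) with h | h
      · rw [greedyShuffle_cons_left h]
        exact cons_mem_shuffles_left (ihA _)
      · rw [greedyShuffle_cons_right h]
        exact cons_mem_shuffles_right ihB

theorem le_greedyShuffle {A B U : List I} (hU : U ∈ shuffles A B) :
    U ≤ greedyShuffle A B := by
  induction A generalizing B U with
  | nil => simp_all [shuffles_nil_left, greedyShuffle_nil_left]
  | cons x A ihA =>
    induction B generalizing U with
    | nil => simp_all [shuffles_nil_right, greedyShuffle_nil_right]
    | cons y B ihB =>
      rcases le_or_gt (y :: B) (x :: A) with h | h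
      · rw [greedyShuffle_cons_left h]
        rcases mem_shuffles_cons_cons.1 hU with ⟨T, hT, rfl⟩ | ⟨T, hT, rfl⟩
        · exact cons_le_cons_iff.2 (Or.inr ⟨rfl, ihA hT⟩)
        · rcases cons_le_cons_iff.1 h with hlt | ⟨rfl, hle⟩
          · exact cons_le_cons_iff.2 (Or.inl hlt)
          · obtain ⟨S, hS, hTS⟩ := exists_ge_shuffle_exchange [y] A B hle hT
            exact cons_le_cons_iff.2 (Or.inr ⟨rfl, hTS.trans (ihA hS)⟩)
      · rw [greedyShuffle_cons_right h]
        rcases mem_shuffles_cons_cons.1 hU with ⟨T, hT, rfl⟩ | ⟨T, hT, rfl⟩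
        · rcases cons_le_cons_iff.1 h.le with hlt | ⟨rfl, hle⟩
          · exact cons_le_cons_iff.2 (Or.inl hlt)
          · obtain ⟨S, hS, hTS⟩ := exists_ge_shuffle_exchange [x] B A hle
              (shuffles_comm A (x :: B) ▸ hT)
            exact cons_le_cons_iff.2
              (Or.inr ⟨rfl, hTS.trans (ihB (shuffles_comm B (x :: A) ▸ hS))⟩)
        · exact cons_le_cons_iff.2 (Or.inr ⟨rfl, ihB hT⟩)

theorem greedyShuffle_comm (A B : List I) : greedyShuffle A B = greedyShuffle B A :=
  le_antisymm (le_greedyShuffle (shuffles_comm A B ▸ greedyShuffle_mem A B))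
    (le_greedyShuffle (shuffles_comm B A ▸ greedyShuffle_mem B A))

theorem eq_greedyShuffle_iff {W A B : List I} :
    W = greedyShuffle A B ↔ W ∈ shuffles A B ∧ ∀ U ∈ shuffles A B, U ≤ W := by
  refine ⟨?_, fun h => le_antisymm (le_greedyShuffle h.1) (h.2 _ (greedyShuffle_mem A B))⟩
  rintro rfl
  exact ⟨greedyShuffle_mem A B, fun U => le_greedyShuffle⟩

theorem greedyShuffle_mono_left {A A' : List I} (B : List I) (h : A ≤ A') :
    greedyShuffle A B ≤ greedyShuffle A' B := by
  obtain ⟨T, hT, hle⟩ := exists_ge_shuffle_of_le h (greedyShuffle_mem A B)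
  exact hle.trans (le_greedyShuffle hT)

theorem exists_greedyShuffle_eq_append (A : List I) {B : List I} (hB : B ≠ []) :
    ∃ P S, A = P ++ S ∧ S < B ∧ greedyShuffle A B = P ++ greedyShuffle S B := by
  induction A with
  | nil => exact ⟨[], [], rfl, nil_lt_of_ne_nil hB, rfl⟩
  | cons x A ih =>
    rcases lt_or_ge (x :: A) B with h | h
    · exact ⟨[], x :: A, rfl, h, rfl⟩
    · obtain ⟨P, S, rfl, hS, hP⟩ := ih
      exact ⟨x :: P, S, rfl, hS, by rw [greedyShuffle_cons_left h, hP, List.cons_append]⟩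

theorem not_isLyndonWord_greedyShuffle {A B : List I} (hA : A ≠ []) (hB : B ≠ []) :
    ¬ IsLyndonWord (greedyShuffle A B) := by
  wlog hBA : B ≤ A generalizing A B
  · rw [greedyShuffle_comm]
    exact this hB hA (le_of_not_ge hBA)
  intro hL
  obtain ⟨P, S, rfl, hS, hP⟩ := exists_greedyShuffle_eq_append A hB
  have hP0 : P ≠ [] := by
    rintro rfl
    exact absurd hS (not_lt.2 hBA)
  refine absurd (hL.2 _ _ hP0 ?_ hP) (not_lt.2 (greedyShuffle_mono_left B (hS.le.trans hBA)))
  refine ne_nil_of_mem_shuffles (v := B) (w := S) ?_ hB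
  rw [shuffles_comm]
  exact greedyShuffle_mem S B

theorem greedyShuffle_eq_append {P N : List I}
    (h : ∀ Q R, P = Q ++ R → R ≠ [] → N ≤ R) : greedyShuffle P N = P ++ N := by
  induction P with
  | nil => simp [greedyShuffle_nil_left]
  | cons x P ih =>
    rw [greedyShuffle_cons_left (h [] _ rfl (by simp)), ih, List.cons_append]
    rintro Q R rfl hR
    exact h (x :: Q) R rfl hR

theorem exists_min_suffix {V : List I} (hV : V ≠ []) :
    ∃ P N, V = P ++ N ∧ N ≠ [] ∧ ∀ Q R, V = Q ++ R → R ≠ [] → N ≤ R := by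
  obtain ⟨N, hN, hmin⟩ := Finset.exists_min_image (V.tails.toFinset.erase []) id
    ⟨V, by simp [hV]⟩
  simp only [Finset.mem_erase, List.mem_toFinset, List.mem_tails, id] at hN hmin
  obtain ⟨hN0, P, rfl⟩ := hN
  exact ⟨P, N, rfl, hN0, fun Q R h hR => hmin R ⟨hR, Q, h.symm⟩⟩

theorem prefix_of_le_of_le_append {R N T : List I} (h : R ≤ N) (h' : N ≤ R ++ T) :
    R <+: N := by
  induction R generalizing N with
  | nil => exact List.nil_prefix
  | cons x R ih =>
    rcases N with _ | ⟨y, N⟩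
    · exact absurd h (not_cons_le_nil _ _)
    rw [List.cons_append] at h'
    rcases cons_le_cons_iff.1 h with h1 | ⟨rfl, h1⟩ <;>
      rcases cons_le_cons_iff.1 h' with h2 | ⟨h2, h3⟩
    · exact absurd h1 h2.asymm
    · exact absurd h1 (h2 ▸ lt_irrefl _)
    · exact absurd h2 (lt_irrefl _)
    · simpa using ih h1 h3

theorem exists_eq_greedyShuffle_of_not_isLyndonWord {V : List I} (hV : V ≠ [])
    (hL : ¬ IsLyndonWord V) : ∃ A B, A ≠ [] ∧ B ≠ [] ∧ V = greedyShuffle A B := by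
  obtain ⟨P, N, rfl, hN, hmin⟩ := exists_min_suffix hV
  refine ⟨P, N, ?_, hN, (greedyShuffle_eq_append ?_).symm⟩
  · rintro rfl
    refine hL ⟨hV, fun A U hA hU h => lt_of_le_of_ne (hmin A U h hU) fun h' => hA ?_⟩
    have := congrArg List.length h
    have := congrArg List.length h'
    simp only [List.nil_append, List.length_append] at *
    exact List.length_eq_zero_iff.1 (by omega)
  · rintro Q R rfl hR
    by_contra! hlt
    obtain ⟨Y, rfl⟩ := prefix_of_le_of_le_append hlt.le
      (hmin Q (R ++ N) (by simp) (by simp [hR]))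
    have hY : Y ≠ [] := by
      rintro rfl
      simp at hlt
    have h1 := hmin (Q ++ R ++ R) Y (by simp) hY
    have h2 := hmin Q (R ++ (R ++ Y)) (by simp) (by simp [hR])
    exact hR (List.self_eq_append_left.1 (le_antisymm ((append_le_append_iff_left R _ _).1 h2) h1))

end GreatestShuffle

section LeadingVariable

variable {I : Type*} [LinearOrder I]

theorem dlexLt_irrefl (V : List I) : ¬ DlexLt V V := by
  simp [DlexLt]

theorem DlexLt.trans {U V W : List I} (h : DlexLt U V) (h' : DlexLt V W) : DlexLt U W := by
  rcases h with h | ⟨h1, h2⟩ <;> rcases h' with h' | ⟨h1', h2'⟩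
  · exact Or.inl (h.trans h')
  · exact Or.inl (h1' ▸ h)
  · exact Or.inl (h1 ▸ h')
  · exact Or.inr ⟨h1.trans h1', h2.trans h2'⟩

theorem DlexLt.trans_le {U V W : List I} (h : DlexLt U V) (h' : DlexLe V W) : DlexLt U W := by
  rcases h' with h' | rfl
  exacts [h.trans h', h]

theorem dlexLt_of_not_dlexLe {V W : List I} (h : ¬ DlexLe V W) : DlexLt W V := by
  rcases (dlexLe_total V W).resolve_left h with h' | rfl
  exacts [h', absurd (Or.inr rfl) h]

theorem DlexLe.antisymm {V W : List I} (h : DlexLe V W) (h' : DlexLe W V) : V = W := by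
  rcases h with h | h
  exacts [absurd (h.trans_le h') (dlexLt_irrefl V), h]

theorem not_pairLt_self (p : WordPair I) : ¬ PairLt p p := by
  simp [PairLt, dlexLt_irrefl]

theorem PairLe.antisymm {p q : WordPair I} (h : PairLe p q) (h' : PairLe q p) : p = q := by
  rcases h with h | h
  · rcases h' with h' | h'
    · exfalso
      rcases h with h | ⟨h0, h | ⟨h1, h⟩⟩ <;> rcases h' with h' | ⟨h0', h' | ⟨h1', h'⟩⟩
      any_goals omega
      · exact dlexLt_irrefl _ (h.trans h')
      · exact dlexLt_irrefl _ (h1' ▸ h)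
      · exact dlexLt_irrefl _ (h1 ▸ h')
      · exact dlexLt_irrefl _ (h.trans h')
    · exact h'.symm
  · exact h

/-- The pair of words underlying `chi A B`. -/
noncomputable def sortPair (A B : List I) : List I × List I :=
  if DlexLe A B then (A, B) else (B, A)

theorem chi_val {A B : List I} (hA : A ≠ []) (hB : B ≠ []) :
    (chi A B hA hB).val = sortPair A B := by
  unfold chi sortPair
  split_ifs <;> rfl

theorem sortPair_of_le {A B : List I} (h : DlexLe A B) : sortPair A B = (A, B) :=
  if_pos h

theorem sortPair_of_ge {A B : List I} (h : DlexLe B A) : sortPair A B = (B, A) := by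
  by_cases h' : DlexLe A B
  · obtain rfl := h.antisymm h'
    exact if_pos h'
  · exact if_neg h'

theorem length_add_length_sortPair (A B : List I) :
    (sortPair A B).1.length + (sortPair A B).2.length = A.length + B.length := by
  unfold sortPair
  split_ifs
  exacts [rfl, add_comm _ _]

theorem pairLt_of_length_lt {p q : WordPair I} {A B A' B' : List I} (hp : p.val = sortPair A B)
    (hq : q.val = sortPair A' B') (h : A.length + B.length < A'.length + B'.length) :
    PairLt p q := by
  refine Or.inl ?_
  rwa [hp, hq, length_add_length_sortPair, length_add_length_sortPair]

theorem pairLt_sortPair_of_dlexLt {p q : WordPair I} {A U M B : List I}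
    (hp : p.val = sortPair A U) (hq : q.val = sortPair M B) (hAM : DlexLt A M)
    (hAB : DlexLt A B) (h : A.length + U.length = M.length + B.length)
    (hAU : DlexLe A U) : PairLt p q := by
  refine Or.inr ⟨?_, Or.inl ?_⟩
  · rwa [hp, hq, length_add_length_sortPair, length_add_length_sortPair]
  · rw [hp, hq, sortPair_of_le hAU]
    rcases dlexLe_total M B with h' | h'
    · rwa [sortPair_of_le h']
    · rwa [sortPair_of_ge h']

theorem pairLe_sortPair_of_le {p q : WordPair I} {U M B : List I} (hp : p.val = sortPair U B)
    (hq : q.val = sortPair M B) (hlen : U.length = M.length) (h : U ≤ M) : PairLe p q := by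
  rcases h.lt_or_eq with h | rfl
  swap
  · exact Or.inr (Subtype.ext (hp.trans hq.symm))
  have hUM : DlexLt U M := Or.inr ⟨hlen, h⟩
  refine Or.inl (Or.inr ⟨?_, ?_⟩)
  · rw [hp, hq, length_add_length_sortPair, length_add_length_sortPair, hlen]
  · rw [hp, hq]
    by_cases hMB : DlexLe M B
    · rw [sortPair_of_le hMB, sortPair_of_le (Or.inl (hUM.trans_le hMB))]
      exact Or.inl hUM
    · have hBM := dlexLt_of_not_dlexLe hMB
      rw [sortPair_of_ge (Or.inl hBM)]
      by_cases hUB : DlexLe U B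
      · rw [sortPair_of_le hUB]
        rcases hUB with hUB | rfl
        exacts [Or.inl hUB, Or.inr ⟨rfl, hBM⟩]
      · rw [sortPair_of_ge (Or.inl (dlexLt_of_not_dlexLe hUB))]
        exact Or.inr ⟨rfl, hUM⟩

open MvPolynomial

variable (C : Type*) [CommRing C]

theorem Xchi_mem_supported {A B : List I} {s : Set (WordPair I)}
    (h : ∀ p : WordPair I, p.val = sortPair A B → p ∈ s) : Xchi C A B ∈ supported C s := by
  unfold Xchi
  split_ifs with hAB
  · exact Algebra.subset_adjoin ⟨_, h _ (chi_val _ _), rfl⟩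
  · exact zero_mem _

theorem shSumR_mem_supported {A B W : List I} {s : Set (WordPair I)}
    (h : ∀ U ∈ shuffles A B, ∀ p : WordPair I, p.val = sortPair U W → p ∈ s) :
    shSumR C A B W ∈ supported C s := by
  refine multiset_sum_mem _ fun x hx => ?_
  obtain ⟨U, hU, rfl⟩ := Multiset.mem_map.1 hx
  exact Xchi_mem_supported C (h U hU)

theorem shSumL_mem_supported {V A B : List I} {s : Set (WordPair I)}
    (h : ∀ U ∈ shuffles A B, ∀ p : WordPair I, p.val = sortPair V U → p ∈ s) :
    shSumL C V A B ∈ supported C s := by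
  refine multiset_sum_mem _ fun x hx => ?_
  obtain ⟨U, hU, rfl⟩ := Multiset.mem_map.1 hx
  exact Xchi_mem_supported C (h U hU)

theorem coeff_single_Xchi (A B : List I) (q : WordPair I) :
    coeff (Finsupp.single q 1) (Xchi C A B) = if sortPair A B = q.val then 1 else 0 := by
  by_cases hAB : A ≠ [] ∧ B ≠ []
  · rw [Xchi, dif_pos hAB, coeff_X, ← chi_val hAB.1 hAB.2]
    simp only [Finsupp.single_left_inj one_ne_zero, Subtype.val_inj]
  · rw [Xchi, dif_neg hAB, coeff_zero, if_neg]
    intro hq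
    obtain ⟨hV, hW, -⟩ := q.2
    rw [← hq] at hV hW
    rcases dlexLe_total A B with h | h
    · rw [sortPair_of_le h] at hV hW
      exact hAB ⟨hV, hW⟩
    · rw [sortPair_of_ge h] at hV hW
      exact hAB ⟨hW, hV⟩

theorem coeff_single_shSumR (A B W : List I) (q : WordPair I) :
    coeff (Finsupp.single q 1) (shSumR C A B W) =
      ((shuffles A B).countP fun U => sortPair U W = q.val : ℕ) := by
  unfold shSumR
  induction shuffles A B using Multiset.induction_on with
  | empty => simp
  | cons U s ih =>
    rw [Multiset.map_cons, Multiset.sum_cons, coeff_add, ih, coeff_single_Xchi,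
      Multiset.countP_cons]
    split_ifs <;> simp [add_comm]

theorem coeff_single_eq_zero_of_mem_supported {s : Set (WordPair I)} {q : WordPair I}
    (hq : q ∉ s) {f : MvPolynomial (WordPair I) C} (hf : f ∈ supported C s) :
    coeff (Finsupp.single q 1) f = 0 := by
  by_contra h
  refine hq (mem_supported.1 hf ?_)
  exact (mem_vars_iff_mem_support q).2 ⟨_, mem_support_iff.2 h, by simp⟩

variable {C}

theorem rPoly_sub_shSumR_mem_supported {V1 V2 V3 : List I} (h1 : V1 ≠ []) (h2 : V2 ≠ [])
    (h3 : V3 ≠ []) (h13 : DlexLt V1 V3) {q : WordPair I}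
    (hq : q.val = sortPair (greedyShuffle V1 V2) V3) :
    rPoly C V1 V2 V3 - shSumR C V1 V2 V3 ∈ supported C {p | PairLt p q} := by
  have hM := length_of_mem_shuffles (greedyShuffle_mem V1 V2)
  have hn := List.length_pos_of_ne_nil h1
  have hm := List.length_pos_of_ne_nil h2
  have hl := List.length_pos_of_ne_nil h3
  have hV13 : V1.length ≤ V3.length := by
    rcases h13 with h | h
    exacts [h.le, h.1.le]
  have hlt {A B : List I} (h : A.length + B.length < V1.length + V2.length + V3.length)
      (p : WordPair I) (hp : p.val = sortPair A B) : p ∈ {p | PairLt p q} :=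
    pairLt_of_length_lt hp hq (by omega)
  have key : rPoly C V1 V2 V3 - shSumR C V1 V2 V3 = - shSumL C V1 V2 V3
      + (rPoly C V1 V2 V3 - (shSumR C V1 V2 V3 - shSumL C V1 V2 V3)) := by ring
  rw [key, rPoly, add_sub_cancel_left]
  refine add_mem (neg_mem (shSumL_mem_supported C fun U hU p hp => ?_))
    (sum_mem fun j hj => sub_mem (sum_mem fun i hi => mul_mem ?_ ?_)
      (sum_mem fun k hk => mul_mem ?_ ?_))
  · have hU' := length_of_mem_shuffles hU
    exact pairLt_sortPair_of_dlexLt hp hq (Or.inl (by omega)) h13 (by omega)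
      (Or.inl (Or.inl (by omega)))
  all_goals simp only [Finset.mem_range, Finset.mem_Ico] at *
  · exact Xchi_mem_supported C (hlt (by simp only [List.length_drop]; omega))
  · refine shSumR_mem_supported C fun U hU => hlt ?_
    have := length_of_mem_shuffles hU
    simp only [List.length_take] at this
    omega
  · refine shSumL_mem_supported C fun U hU => hlt ?_
    have := length_of_mem_shuffles hU
    simp only [List.length_take] at this
    omega
  · exact Xchi_mem_supported C (hlt (by simp only [List.length_drop]; omega))

/-- The greatest variable of `r(V1, V2, V3)` is `χ(M, V3)`, where `M` is the greatest shuffle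
of `V1` and `V2`. -/
theorem isGreatest_vars_rPoly_iff [CharZero C] {V1 V2 V3 : List I} (h1 : V1 ≠ [])
    (h2 : V2 ≠ []) (h3 : V3 ≠ []) (h13 : DlexLt V1 V3) (q : WordPair I) :
    (q ∈ (rPoly C V1 V2 V3).vars ∧ ∀ p ∈ (rPoly C V1 V2 V3).vars, PairLe p q) ↔
      q.val = sortPair (greedyShuffle V1 V2) V3 := by
  have main : ∀ q : WordPair I, q.val = sortPair (greedyShuffle V1 V2) V3 →
      q ∈ (rPoly C V1 V2 V3).vars ∧ ∀ p ∈ (rPoly C V1 V2 V3).vars, PairLe p q := by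
    intro q hq
    have hrest := rPoly_sub_shSumR_mem_supported (C := C) h1 h2 h3 h13 hq
    have hsplit := sub_add_cancel (rPoly C V1 V2 V3) (shSumR C V1 V2 V3)
    constructor
    · refine (mem_vars_iff_mem_support q).2 ⟨Finsupp.single q 1, mem_support_iff.2 ?_, by simp⟩
      rw [← hsplit, coeff_add,
        coeff_single_eq_zero_of_mem_supported C (not_pairLt_self q) hrest, zero_add,
        coeff_single_shSumR, Nat.cast_ne_zero]
      exact (Multiset.countP_pos_of_mem (greedyShuffle_mem V1 V2) hq.symm).ne'
    · refine fun p hp => mem_supported (s := {p | PairLe p q}).1 ?_ hp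
      rw [← hsplit]
      refine add_mem (supported_mono (fun p hp => Or.inl hp) hrest)
        (shSumR_mem_supported C fun U hU p hp => pairLe_sortPair_of_le hp hq ?_
          (le_greedyShuffle hU))
      rw [length_of_mem_shuffles hU, length_of_mem_shuffles (greedyShuffle_mem V1 V2)]
  refine ⟨fun h => ?_, main q⟩
  have hM := chi_val (ne_nil_of_mem_shuffles (greedyShuffle_mem V1 V2) h1) h3
  have h' := main _ hM
  rw [← hM, (h'.2 q h.1).antisymm (h.2 _ h'.1)]

end LeadingVariable

/-- For nonempty words `V ≤dlex W`, the pair `(V, W)` is the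
`≼`-greatest variable of some relation `r(V1,V2,V3)` (with `V1, V2, V3` nonempty and
`V1 <dlex V3`) if and only if `V` is not a Lyndon word, or `W` is the lexicographically
greatest shuffle of two nonempty words `W1, W2` with `W1 <dlex V`. -/
theorem stmt_11 {I : Type*} [LinearOrder I] (C : Type*) [CommRing C] [Algebra ℚ C]
    [Nontrivial C]
    (V W : List I) (hV : V ≠ []) (hW : W ≠ []) (hVW : DlexLe V W) :
    (∃ V1 V2 V3 : List I, V1 ≠ [] ∧ V2 ≠ [] ∧ V3 ≠ [] ∧ DlexLt V1 V3 ∧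
      (⟨(V, W), hV, hW, hVW⟩ : WordPair I) ∈ (rPoly C V1 V2 V3).vars ∧
      ∀ p ∈ (rPoly C V1 V2 V3).vars, PairLe p ⟨(V, W), hV, hW, hVW⟩) ↔
    (¬ IsLyndonWord V ∨
      ∃ W1 W2 : List I, W1 ≠ [] ∧ W2 ≠ [] ∧ DlexLt W1 V ∧
        W ∈ shuffles W1 W2 ∧ ∀ U ∈ shuffles W1 W2, U ≤ W) := by
  have : CharZero C := algebraRat.charZero C
  constructor
  · rintro ⟨V1, V2, V3, h1, h2, h3, h13, h⟩
    rw [isGreatest_vars_rPoly_iff h1 h2 h3 h13] at h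
    unfold sortPair at h
    split_ifs at h <;> obtain ⟨rfl, rfl⟩ := Prod.mk.inj h
    · exact Or.inl (not_isLyndonWord_greedyShuffle h1 h2)
    · exact Or.inr ⟨V1, V2, h1, h2, h13, eq_greedyShuffle_iff.1 rfl⟩
  · rintro (hL | ⟨W1, W2, h1, h2, hlt, hmax⟩)
    · obtain ⟨A, B, hA, hB, rfl⟩ := exists_eq_greedyShuffle_of_not_isLyndonWord hV hL
      have hlt : DlexLt A (greedyShuffle A B) := by
        have := length_of_mem_shuffles (greedyShuffle_mem A B)
        have := List.length_pos_of_ne_nil hB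
        exact Or.inl (by omega)
      have hAW := hlt.trans_le hVW
      exact ⟨A, B, W, hA, hB, hW, hAW, (isGreatest_vars_rPoly_iff hA hB hW hAW _).2
        (sortPair_of_le hVW).symm⟩
    · obtain rfl := eq_greedyShuffle_iff.2 hmax
      exact ⟨W1, W2, V, h1, h2, hV, hlt, (isGreatest_vars_rPoly_iff h1 h2 hV hlt _).2
        (sortPair_of_ge hVW).symm⟩
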